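/- Let q be a positive integer, let x_{i,q}^I be the unique positive real zero of P(x) = −q − 2^{1/(2(1+q))}(1+q)^{(2+q)/(1+q)} x + √2(1+q)x^{1+q}, and set u_{i,q}^I = −x_{i,q}^I. Define for real u: R(u) = 2q − 2^{(3+2q)/(2(1+q))}(1+q)^{(2+q)/(1+q)}·u + (−1)^q·2√2(1+q)·u^{1+q} + q·u^{2(1+q)}, and p₂(u) = √q·((−1)^q√2 + 2u^{1+q})·√R(u) − 2q(−1)^q + (−1)^q·2^{1/(2(1+q))}(1+q)^{1/(1+q)}(3+2q)·u − 3√2(1+q)·u^{1+q} − 2(−1)^q·q·u^{2(1+q)}, where √ is the real square root. Let P⁻ be the polynomial P⁻(u) = 2^{(5+4q)/(2(1+q))} q (1+q)^{1/(1+q)} (2+q) − 2^{1/(1+q)} (1+q)^{2/(1+q)} (3+2q)² u − 8(−1)^q√2 q u^q + (−1)^q 2^{(4+3q)/(2(1+q))} (1+q)^{(2+q)/(1+q)} (9+2q) u^{1+q} − 2(9+10q) u^{1+2q} + 2^{(5+4q)/(2(1+q))} q (1+q)^{1/(1+q)} u^{2(1+q)} − 4(−1)^q√2 q u^{2+3q}.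 If P⁻ has at most one root, counted with multiplicity, in the open interval (−2, 0), then p₂(u) ≠ 0 for every u with u_{i,q}^I ≤ u < 0. -/

import Mathlib

open Polynomial

/-- The polynomial `P⁻` (real powers in the coefficients are `Real.rpow`). -/
noncomputable def chazyPminus (q : ℕ) : Polynomial ℝ :=
  C ((2 : ℝ) ^ ((5 + 4 * (q : ℝ)) / (2 * (1 + (q : ℝ)))) * (q : ℝ)
      * (1 + (q : ℝ)) ^ ((1 : ℝ) / (1 + (q : ℝ))) * (2 + (q : ℝ)))
  - C ((2 : ℝ) ^ ((1 : ℝ) / (1 + (q : ℝ))) * (1 + (q : ℝ)) ^ ((2 : ℝ) / (1 + (q : ℝ)))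
      * (3 + 2 * (q : ℝ)) ^ 2) * X
  - C (8 * (-1 : ℝ) ^ q * Real.sqrt 2 * (q : ℝ)) * X ^ q
  + C ((-1 : ℝ) ^ q * (2 : ℝ) ^ ((4 + 3 * (q : ℝ)) / (2 * (1 + (q : ℝ))))
      * (1 + (q : ℝ)) ^ ((2 + (q : ℝ)) / (1 + (q : ℝ))) * (9 + 2 * (q : ℝ))) * X ^ (1 + q)
  - C (2 * (9 + 10 * (q : ℝ))) * X ^ (1 + 2 * q)
  + C ((2 : ℝ) ^ ((5 + 4 * (q : ℝ)) / (2 * (1 + (q : ℝ)))) * (q : ℝ)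
      * (1 + (q : ℝ)) ^ ((1 : ℝ) / (1 + (q : ℝ)))) * X ^ (2 * (1 + q))
  - C (4 * (-1 : ℝ) ^ q * Real.sqrt 2 * (q : ℝ)) * X ^ (2 + 3 * q)

/-- The polynomial function `P(x) = -q - 2^{1/(2(1+q))}(1+q)^{(2+q)/(1+q)} x + √2(1+q)x^{1+q}`. -/
noncomputable def chazyPfun (q : ℕ) (x : ℝ) : ℝ :=
  -(q : ℝ) - (2 : ℝ) ^ ((1 : ℝ) / (2 * (1 + (q : ℝ))))
      * (1 + (q : ℝ)) ^ ((2 + (q : ℝ)) / (1 + (q : ℝ))) * x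
    + Real.sqrt 2 * (1 + (q : ℝ)) * x ^ (1 + q)

/-- The radicand `R(u)` appearing in the normal component along `U₄`. -/
noncomputable def chazyR4 (q : ℕ) (u : ℝ) : ℝ :=
  2 * (q : ℝ) - (2 : ℝ) ^ ((3 + 2 * (q : ℝ)) / (2 * (1 + (q : ℝ))))
      * (1 + (q : ℝ)) ^ ((2 + (q : ℝ)) / (1 + (q : ℝ))) * u
    + (-1 : ℝ) ^ q * 2 * Real.sqrt 2 * (1 + (q : ℝ)) * u ^ (1 + q)
    + (q : ℝ) * u ^ (2 * (1 + q))

/-- The function `p₂(u)`, the normal component of `X̃_q^-` along `U₄`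
up to the factor `(1+q)u^{q-1}/q`. -/
noncomputable def chazyP2fun (q : ℕ) (u : ℝ) : ℝ :=
  Real.sqrt (q : ℝ) * ((-1 : ℝ) ^ q * Real.sqrt 2 + 2 * u ^ (1 + q)) * Real.sqrt (chazyR4 q u)
    - 2 * (q : ℝ) * (-1 : ℝ) ^ q
    + (-1 : ℝ) ^ q * (2 : ℝ) ^ ((1 : ℝ) / (2 * (1 + (q : ℝ))))
        * (1 + (q : ℝ)) ^ ((1 : ℝ) / (1 + (q : ℝ))) * (3 + 2 * (q : ℝ)) * u
    - 3 * Real.sqrt 2 * (1 + (q : ℝ)) * u ^ (1 + q)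
    - 2 * (-1 : ℝ) ^ q * (q : ℝ) * u ^ (2 * (1 + q))

/-- The number `(√2 (1+q))^{1/(1+q)}`, to which all real powers in the statement reduce. -/
noncomputable def chazyScale (q : ℕ) : ℝ :=
  (2 : ℝ) ^ ((1 : ℝ) / (2 * (1 + (q : ℝ)))) * (1 + (q : ℝ)) ^ ((1 : ℝ) / (1 + (q : ℝ)))

lemma chazyScale_pos (q : ℕ) : 0 < chazyScale q := by
  unfold chazyScale; positivity

lemma chazyScale_pow (q : ℕ) : chazyScale q ^ (1 + q) = √2 * (1 + q) := by
  have hn : (0 : ℝ) < 1 + q := by positivity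
  unfold chazyScale
  rw [mul_pow, ← Real.rpow_natCast, ← Real.rpow_natCast, ← Real.rpow_mul (by norm_num),
    ← Real.rpow_mul hn.le, Real.sqrt_eq_rpow]
  push_cast
  rw [div_mul_cancel₀ _ hn.ne', Real.rpow_one]
  congr 2
  field_simp

lemma two_rpow_natCast_add (q k : ℕ) (e : ℝ)
    (he : e = k / 2 + 1 / (2 * (1 + (q : ℝ)))) :
    (2 : ℝ) ^ e = √2 ^ k * (2 : ℝ) ^ ((1 : ℝ) / (2 * (1 + (q : ℝ)))) := by
  rw [he, Real.rpow_add (by norm_num), Real.sqrt_eq_rpow, ← Real.rpow_natCast,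
    ← Real.rpow_mul (by norm_num)]
  congr 2
  ring

lemma one_add_rpow_two_add_div (q : ℕ) :
    (1 + (q : ℝ)) ^ ((2 + (q : ℝ)) / (1 + (q : ℝ))) =
      (1 + q) * (1 + (q : ℝ)) ^ ((1 : ℝ) / (1 + (q : ℝ))) := by
  have hn : (0 : ℝ) < 1 + q := by positivity
  rw [show (2 + (q : ℝ)) / (1 + q) = 1 + 1 / (1 + q) by field_simp; ring,
    Real.rpow_add hn, Real.rpow_one]

lemma chazyPfun_eq (q : ℕ) (x : ℝ) :
    chazyPfun q x =
      -(q : ℝ) - (1 + q) * chazyScale q * x + √2 * (1 + q) * x ^ (1 + q) := by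
  unfold chazyPfun chazyScale
  rw [one_add_rpow_two_add_div]
  ring

lemma chazyR4_eq (q : ℕ) (u : ℝ) :
    chazyR4 q u = 2 * q - 2 * (1 + q) * chazyScale q * u
      + 2 * √2 * (1 + q) * ((-1) ^ q * u ^ (1 + q)) + q * (u ^ (1 + q)) ^ 2 := by
  have hn : (0 : ℝ) < 1 + q := by positivity
  have h2 : √2 ^ 2 = (2 : ℝ) := Real.sq_sqrt (by norm_num)
  unfold chazyR4 chazyScale
  rw [one_add_rpow_two_add_div,
    two_rpow_natCast_add q 2 ((3 + 2 * (q : ℝ)) / (2 * (1 + q))) (by field_simp; push_cast; ring),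
    h2]
  ring

lemma chazyPminus_eval (q : ℕ) (u : ℝ) :
    (chazyPminus q).eval u = 4 * chazyScale q * q * (2 + q)
      - chazyScale q ^ 2 * (3 + 2 * q) ^ 2 * u - 8 * (-1) ^ q * √2 * q * u ^ q
      + (-1) ^ q * 2 * √2 * chazyScale q * (1 + q) * (9 + 2 * q) * u ^ (1 + q)
      - 2 * (9 + 10 * q) * u ^ (1 + 2 * q) + 4 * chazyScale q * q * u ^ (2 * (1 + q))
      - 4 * (-1) ^ q * √2 * q * u ^ (2 + 3 * q) := by
  have hn : (0 : ℝ) < 1 + q := by positivity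
  have h2 : √2 ^ 2 = (2 : ℝ) := Real.sq_sqrt (by norm_num)
  have h3 : √2 ^ 3 = (2 : ℝ) * √2 := by rw [pow_succ, h2]
  have h4 : √2 ^ 4 = (4 : ℝ) := by rw [show 4 = 2 * 2 from rfl, pow_mul, h2]; norm_num
  have e2 : (2 : ℝ) ^ ((1 : ℝ) / (1 + q)) = ((2 : ℝ) ^ ((1 : ℝ) / (2 * (1 + q)))) ^ 2 := by
    rw [← Real.rpow_natCast, ← Real.rpow_mul (by norm_num)]
    congr 1; field_simp; push_cast; ring
  have en : (1 + (q : ℝ)) ^ ((2 : ℝ) / (1 + q)) = ((1 + (q : ℝ)) ^ ((1 : ℝ) / (1 + q))) ^ 2 := by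
    rw [← Real.rpow_natCast, ← Real.rpow_mul hn.le]
    congr 1; field_simp; push_cast; ring
  unfold chazyPminus chazyScale
  simp only [eval_add, eval_sub, eval_mul, eval_C, eval_X, eval_pow]
  rw [one_add_rpow_two_add_div, e2, en,
    two_rpow_natCast_add q 4 ((5 + 4 * (q : ℝ)) / (2 * (1 + q))) (by field_simp; push_cast; ring),
    two_rpow_natCast_add q 3 ((4 + 3 * (q : ℝ)) / (2 * (1 + q))) (by field_simp; push_cast; ring),
    h3, h4]
  ring

/-- The part of `(-1)^q p₂` containing the square root. -/
noncomputable def chazyRadicalPart (q : ℕ) (u : ℝ) : ℝ :=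
  √q * (√2 + 2 * ((-1) ^ q * u ^ (1 + q))) * √(chazyR4 q u)

/-- The polynomial part of `(-1)^q p₂`, with the opposite sign. -/
noncomputable def chazyPolyPart (q : ℕ) (u : ℝ) : ℝ :=
  2 * q - chazyScale q * (3 + 2 * q) * u + 3 * √2 * (1 + q) * ((-1) ^ q * u ^ (1 + q))
    + 2 * q * (u ^ (1 + q)) ^ 2

lemma neg_one_pow_mul_self_real (q : ℕ) : ((-1 : ℝ) ^ q) * (-1) ^ q = 1 := by
  rw [← mul_pow]; norm_num

lemma chazyP2fun_eq (q : ℕ) (u : ℝ) :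
    chazyP2fun q u = (-1) ^ q * (chazyRadicalPart q u - chazyPolyPart q u) := by
  have hs := neg_one_pow_mul_self_real q
  unfold chazyP2fun chazyRadicalPart chazyPolyPart chazyScale
  linear_combination (-2 * √q * u ^ (1 + q) * √(chazyR4 q u)
    + 3 * √2 * (1 + q) * u ^ (1 + q)) * hs

lemma sub_mul_add_eq_mul_chazyPminus (q : ℕ) (u : ℝ) (hR : 0 ≤ chazyR4 q u) :
    (chazyRadicalPart q u - chazyPolyPart q u) * (chazyRadicalPart q u + chazyPolyPart q u)
      = u * (chazyPminus q).eval u := by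
  have hs := neg_one_pow_mul_self_real q
  have h2 : √2 ^ 2 = (2 : ℝ) := Real.sq_sqrt (by norm_num)
  have hq : √(q : ℝ) ^ 2 = q := Real.sq_sqrt (by positivity)
  have hsq : chazyRadicalPart q u ^ 2
      = q * (√2 + 2 * ((-1) ^ q * u ^ (1 + q))) ^ 2 * chazyR4 q u := by
    rw [chazyRadicalPart, mul_pow, mul_pow, hq, Real.sq_sqrt hR]
  have hW : ((-1) ^ q * u ^ (1 + q)) ^ 2 = (u ^ (1 + q)) ^ 2 := by
    rw [mul_pow, pow_two ((-1 : ℝ) ^ q), hs, one_mul]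
  have hP : u * (chazyPminus q).eval u = 4 * chazyScale q * q * (2 + q) * u
      - chazyScale q ^ 2 * (3 + 2 * q) ^ 2 * u ^ 2 - 8 * √2 * q * ((-1) ^ q * u ^ (1 + q))
      + 2 * √2 * chazyScale q * (1 + q) * (9 + 2 * q) * u * ((-1) ^ q * u ^ (1 + q))
      - 2 * (9 + 10 * q) * (u ^ (1 + q)) ^ 2 + 4 * chazyScale q * q * u * (u ^ (1 + q)) ^ 2
      - 4 * √2 * q * ((-1) ^ q * u ^ (1 + q)) * (u ^ (1 + q)) ^ 2 := by
    rw [chazyPminus_eval]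
    ring
  rw [hP, ← hW, mul_comm, ← sq_sub_sq, hsq, chazyR4_eq, chazyPolyPart, ← hW]
  generalize (-1) ^ q * u ^ (1 + q) = W
  generalize chazyScale q = c
  generalize √2 = r at *
  generalize (q : ℝ) = t at *
  linear_combination (t * (2 * t - 2 * (1 + t) * c * u + t * W ^ 2 + 2 * r * (1 + t) * W
    + 8 * (1 + t) * W ^ 2) - 9 * (1 + t) ^ 2 * W ^ 2) * h2

lemma chazyR4_neg (q : ℕ) (x : ℝ) :
    chazyR4 q (-x) = q * (x ^ (1 + q)) ^ 2 - 2 * chazyPfun q x := by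
  have hs := neg_one_pow_mul_self_real q
  rw [chazyR4_eq, chazyPfun_eq, neg_pow, pow_add]
  linear_combination (q * (x ^ (1 + q)) ^ 2 - 2 * √2 * (1 + q) * x ^ (1 + q)) * hs

lemma continuous_chazyPfun (q : ℕ) : Continuous (chazyPfun q) := by
  unfold chazyPfun; fun_prop

lemma differentiable_chazyR4 (q : ℕ) : Differentiable ℝ (chazyR4 q) := by
  unfold chazyR4; fun_prop

lemma differentiable_chazyPolyPart (q : ℕ) : Differentiable ℝ (chazyPolyPart q) := by
  unfold chazyPolyPart; fun_prop

lemma continuous_chazyRadicalPart (q : ℕ) : Continuous (chazyRadicalPart q) := by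
  have := (differentiable_chazyR4 q).continuous
  unfold chazyRadicalPart; fun_prop

lemma differentiableAt_chazyRadicalPart {q : ℕ} {u : ℝ} (hR : 0 < chazyR4 q u) :
    DifferentiableAt ℝ (chazyRadicalPart q) u := by
  have := ((differentiable_chazyR4 q) u).sqrt hR.ne'
  unfold chazyRadicalPart
  fun_prop

lemma exists_chazyPfun_root {q : ℕ} (hq : 1 ≤ q) {x : ℝ} (hx : 0 < x)
    (hP : 0 < chazyPfun q x) : ∃ y, 0 < y ∧ y < x ∧ chazyPfun q y = 0 := by
  have h0 : chazyPfun q 0 < 0 := by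
    have : (0 : ℝ) < q := by exact_mod_cast hq
    simpa [chazyPfun_eq] using this
  obtain ⟨y, ⟨hy0, hyx⟩, hy⟩ :=
    intermediate_value_Ioo hx.le (continuous_chazyPfun q).continuousOn ⟨h0, hP⟩
  exact ⟨y, hy0, hyx, hy⟩

lemma chazyPfun_two_pos {q : ℕ} (hq : 1 ≤ q) : 0 < chazyPfun q 2 := by
  have hq' : (1 : ℝ) ≤ q := by exact_mod_cast hq
  have hr : (7 / 5 : ℝ) < √2 := Real.lt_sqrt_of_sq_lt (by norm_num)
  have hr' : √2 ≤ 2 := by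
    rw [Real.sqrt_le_left (by norm_num)]; norm_num
  have hpow : (1 : ℝ) + q ≤ 2 ^ q := by
    have := one_add_mul_le_pow (show (-2 : ℝ) ≤ 1 by norm_num) q
    norm_num at this
    exact this
  have hc : chazyScale q ≤ 2 := by
    refine le_of_pow_le_pow_left₀ (n := 1 + q) (by omega) (by norm_num) ?_
    rw [chazyScale_pow, pow_add]
    nlinarith
  have h4 : (4 : ℝ) ≤ 2 ^ (1 + q) := by
    rw [pow_add]; linarith
  rw [chazyPfun_eq]
  nlinarith [mul_le_mul_of_nonneg_left h4 (show 0 ≤ √2 * (1 + q) by positivity),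
    mul_le_mul_of_nonneg_left hc (show (0 : ℝ) ≤ 1 + q by positivity),
    mul_pos (sub_pos.2 hr) (show (0 : ℝ) < 1 + q by positivity)]

lemma radicalPart_lt_polyPart_of_root {q : ℕ} (hq : 1 ≤ q) {x : ℝ} (hx : 0 < x)
    (hP : chazyPfun q x = 0) : chazyRadicalPart q (-x) < chazyPolyPart q (-x) := by
  have hq' : (1 : ℝ) ≤ q := by exact_mod_cast hq
  have hn : (0 : ℝ) < 1 + q := by positivity
  have hs := neg_one_pow_mul_self_real q
  have h2 : √2 ^ 2 = (2 : ℝ) := Real.sq_sqrt (by norm_num)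
  have hW : (-1) ^ q * (-x) ^ (1 + q) = -x ^ (1 + q) := by
    rw [neg_pow, pow_add]; linear_combination (-x ^ (1 + q)) * hs
  have hW2 : ((-x) ^ (1 + q)) ^ 2 = (x ^ (1 + q)) ^ 2 := by
    rw [← pow_mul, ← pow_mul, mul_comm, pow_mul, pow_mul, neg_sq]
  have hsqrt : √(chazyR4 q (-x)) = √q * x ^ (1 + q) := by
    rw [chazyR4_neg, hP, mul_zero, sub_zero, Real.sqrt_mul (by positivity),
      Real.sqrt_sq (by positivity)]
  have hA : chazyRadicalPart q (-x) = q * (√2 - 2 * x ^ (1 + q)) * x ^ (1 + q) := by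
    rw [chazyRadicalPart, hsqrt, hW]
    linear_combination (√2 - 2 * x ^ (1 + q)) * x ^ (1 + q) *
      Real.sq_sqrt (show (0 : ℝ) ≤ q by positivity)
  have hy0 : 0 < chazyScale q * x := mul_pos (chazyScale_pos q) hx
  have hypow : (chazyScale q * x) ^ (1 + q) = √2 * (1 + q) * x ^ (1 + q) := by
    rw [mul_pow, chazyScale_pow]
  rw [chazyPfun_eq] at hP
  have hy1 : 1 < chazyScale q * x := by
    by_contra! h
    have := pow_le_of_le_one hy0.le h (show 1 + q ≠ 0 by omega)
    nlinarith
  rw [hA, chazyPolyPart, hW, hW2]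
  generalize hY : x ^ (1 + q) = Y at *
  generalize hZ : chazyScale q * x = y at *
  have hz : y + 1 / 2 ≤ √2 * Y := by
    have : (1 + q) * (y + 1 / 2) ≤ (1 + q) * (√2 * Y) := by rw [← hZ] at *; nlinarith
    exact le_of_mul_le_mul_left this hn
  have hYY : (√2 * Y) ^ 2 = 2 * Y ^ 2 := by rw [mul_pow, h2]
  have hkey : √2 * Y - 4 * Y ^ 2 + 1 + y < 0 := by nlinarith
  have := mul_neg_of_pos_of_neg (show (0 : ℝ) < q by positivity) hkey
  rw [← hZ] at this
  linarith

lemma chazyPminus_eval_zero_pos {q : ℕ} (hq : 1 ≤ q) : 0 < (chazyPminus q).eval 0 := by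
  have hq' : (0 : ℝ) < q := by exact_mod_cast hq
  have := chazyScale_pos q
  rw [chazyPminus_eval]
  simp only [zero_pow (show q ≠ 0 by omega), zero_pow (show 1 + q ≠ 0 by omega),
    zero_pow (show 1 + 2 * q ≠ 0 by omega), zero_pow (show 2 * (1 + q) ≠ 0 by omega),
    zero_pow (show 2 + 3 * q ≠ 0 by omega), mul_zero, sub_zero, add_zero]
  positivity

open Filter Topology in
lemma eventually_radicalPart_lt_polyPart {q : ℕ} (hq : 1 ≤ q) :
    ∀ᶠ u in 𝓝[<] (0 : ℝ), chazyRadicalPart q u < chazyPolyPart q u := by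
  have hP : ∀ᶠ u in 𝓝 (0 : ℝ), 0 < (chazyPminus q).eval u :=
    (chazyPminus q).continuous.continuousAt.eventually (lt_mem_nhds (chazyPminus_eval_zero_pos hq))
  have hB : ∀ᶠ u in 𝓝 (0 : ℝ), 0 < chazyPolyPart q u :=
    (differentiable_chazyPolyPart q).continuous.continuousAt.eventually
      (lt_mem_nhds (by simp [chazyPolyPart]; omega))
  have hR : ∀ᶠ u in 𝓝 (0 : ℝ), 0 < chazyR4 q u :=
    (differentiable_chazyR4 q).continuous.continuousAt.eventually
      (lt_mem_nhds (by simp [chazyR4_eq]; omega))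
  filter_upwards [nhdsWithin_le_nhds hP, nhdsWithin_le_nhds hB, nhdsWithin_le_nhds hR,
    self_mem_nhdsWithin] with u hPu hBu hRu hu
  have h := sub_mul_add_eq_mul_chazyPminus q u hRu.le
  have := mul_neg_of_neg_of_pos (show u < 0 from hu) hPu
  nlinarith

lemma eq_of_isRoot_of_card_filter_roots_le_one {p : ℝ[X]} (hp : p ≠ 0) {S : ℝ → Prop}
    [DecidablePred S] (h : (p.roots.filter S).card ≤ 1) {a b : ℝ} (ha : p.IsRoot a)
    (hb : p.IsRoot b) (hSa : S a) (hSb : S b) : a = b := by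
  by_contra hab
  have hle : ({a, b} : Multiset ℝ) ≤ p.roots.filter S := by
    rw [Multiset.le_iff_subset (by simpa using hab)]
    intro c hc
    simp only [Multiset.insert_eq_cons, Multiset.mem_cons, Multiset.mem_singleton] at hc
    rcases hc with rfl | rfl
    · simp [hp, ha.eq_zero, hSa]
    · simp [hp, hb.eq_zero, hSb]
  have := Multiset.card_le_card hle
  simp at this
  omega

lemma derivative_eval_ne_zero_of_card_filter_roots_le_one {p : ℝ[X]} (hp : p ≠ 0) {S : ℝ → Prop}
    [DecidablePred S] (h : (p.roots.filter S).card ≤ 1) {a : ℝ} (ha : p.IsRoot a) (hSa : S a) :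
    p.derivative.eval a ≠ 0 := by
  intro hd
  have h1 := (one_lt_rootMultiplicity_iff_isRoot hp).2 ⟨ha, hd⟩
  have h2 := Multiset.count_le_card a (p.roots.filter S)
  rw [Multiset.count_filter_of_pos hSa, count_roots] at h2
  omega

/-- Proposition 4.4: if `P⁻` has at most one root, counted with multiplicity, in
`(-2, 0)`, then `p₂` does not vanish on `[u_{i,q}^I, 0)`, where
`u_{i,q}^I = -x_{i,q}^I` and `x_{i,q}^I` is the unique positive zero of `P`. -/
theorem chazy_U4_transversal (q : ℕ) (hq : 1 ≤ q) (xI : ℝ)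
    (hxI_pos : 0 < xI) (hxI_root : chazyPfun q xI = 0)
    (hxI_unique : ∀ y : ℝ, 0 < y → chazyPfun q y = 0 → y = xI)
    (hC3 : (((chazyPminus q).roots).filter
      (fun u => -2 < u ∧ u < 0)).card ≤ 1) :
    ∀ u : ℝ, -xI ≤ u → u < 0 → chazyP2fun q u ≠ 0 := by
  intro u hu hu0 hzero
  have hq' : (0 : ℝ) < q := by exact_mod_cast hq
  have hp : chazyPminus q ≠ 0 := by
    intro h
    have := chazyPminus_eval_zero_pos hq
    simp [h] at this
  have hxI2 : xI < 2 := by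
    obtain ⟨y, hy0, hy2, hy⟩ := exists_chazyPfun_root hq two_pos (chazyPfun_two_pos hq)
    exact hxI_unique y hy0 hy ▸ hy2
  have hR : ∀ v, -xI ≤ v → v < 0 → 0 < chazyR4 q v := by
    intro v hv hv0
    have hP : chazyPfun q (-v) ≤ 0 := by
      by_contra! h
      obtain ⟨y, hy0, hyv, hy⟩ := exists_chazyPfun_root hq (neg_pos.2 hv0) h
      linarith [hxI_unique y hy0 hy]
    have := chazyR4_neg q (-v)
    rw [neg_neg] at this
    have hpos : 0 < (q : ℝ) * ((-v) ^ (1 + q)) ^ 2 := by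
      have := neg_pos.2 hv0
      positivity
    linarith
  set h : ℝ → ℝ := fun v => chazyRadicalPart q v - chazyPolyPart q v
  have hcont : Continuous h :=
    (continuous_chazyRadicalPart q).sub (differentiable_chazyPolyPart q).continuous
  have hroot : ∀ v, -xI ≤ v → v < 0 → h v = 0 → (chazyPminus q).IsRoot v := by
    intro v hv hv0 hz
    have hid := sub_mul_add_eq_mul_chazyPminus q v (hR v hv hv0).le
    rw [show chazyRadicalPart q v - chazyPolyPart q v = 0 from hz, zero_mul] at hid
    exact (mul_eq_zero.1 hid.symm).resolve_left hv0.ne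
  have hleft : h (-xI) < 0 :=
    sub_neg.2 (radicalPart_lt_polyPart_of_root hq hxI_pos hxI_root)
  have hu_zero : h u = 0 := by
    rw [chazyP2fun_eq] at hzero
    exact (mul_eq_zero.1 hzero).resolve_left (pow_ne_zero _ (by norm_num))
  have hu' : -xI < u := lt_of_le_of_ne hu (by rintro rfl; exact hleft.ne hu_zero)
  by_cases hpos : ∃ v, -xI ≤ v ∧ v < 0 ∧ 0 < h v
  · obtain ⟨v, hv, hv0, hhv⟩ := hpos
    obtain ⟨a, ⟨ha, hav⟩, ha0⟩ := intermediate_value_Ioo hv hcont.continuousOn ⟨hleft, hhv⟩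
    obtain ⟨w, hw, hvw, hw0⟩ := ((eventually_radicalPart_lt_polyPart hq).and
      (Ioo_mem_nhdsLT hv0)).exists
    obtain ⟨b, ⟨hvb, hbw⟩, hb0⟩ :=
      intermediate_value_Ioo' hvw.le hcont.continuousOn ⟨sub_neg.2 hw, hhv⟩
    have hab := eq_of_isRoot_of_card_filter_roots_le_one hp hC3
      (hroot a ha.le (hav.trans hv0) ha0) (hroot b (hv.trans hvb.le) (hbw.trans hw0) hb0)
      ⟨by linarith, by linarith⟩ ⟨by linarith, by linarith⟩
    linarith
  · push Not at hpos
    have hmax : IsLocalMax h u := by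
      filter_upwards [Ioo_mem_nhds hu' hu0] with v hv
      rw [hu_zero]
      exact hpos v hv.1.le hv.2
    have hA := differentiableAt_chazyRadicalPart (hR u hu hu0)
    have hB := differentiable_chazyPolyPart q u
    have hd : HasDerivAt h 0 u := by
      have := (hA.sub hB).hasDerivAt
      exact hmax.hasDerivAt_eq_zero this ▸ this
    have hprod := hd.mul (hA.add hB).hasDerivAt
    have hpoly := (hasDerivAt_id u).mul ((chazyPminus q).hasDerivAt u)
    have heq : (h * (chazyRadicalPart q + chazyPolyPart q)) =ᶠ[nhds u]
        (id * fun v => (chazyPminus q).eval v) := by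
      filter_upwards [Ioo_mem_nhds hu' hu0] with v hv
      exact sub_mul_add_eq_mul_chazyPminus q v (hR v hv.1.le hv.2).le
    have hderiv := (hpoly.congr_of_eventuallyEq heq).unique hprod
    have hru := hroot u hu hu0 hu_zero
    rw [hu_zero, hru.eq_zero] at hderiv
    simp only [mul_zero, zero_mul, zero_add, add_zero, id] at hderiv
    exact derivative_eval_ne_zero_of_card_filter_roots_le_one hp hC3 hru
      ⟨by linarith, hu0⟩ ((mul_eq_zero.1 hderiv).resolve_left hu0.ne)
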